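/- Let β > 0, γ ∈ ℝ and d ≥ 1. There exists a constant C < ∞ depending only on β and γ such that for all φ, ξ ∈ ℝ^d with (φ,ξ) ≠ (0,0) and every measurable function f : ℝ → [0,∞], one has ∫_ℝ W(t,φ,ξ)^{2γ} · (∫_{−∞}^t K(t,s,φ,ξ) · f(s) ds)² dt ≤ C · ∫_ℝ W(s,φ,ξ)^{2γ−4β} · f(s)² ds. -/

import Mathlib

open MeasureTheory Real
open scoped ENNReal

/-- The weight `W(t,φ,ξ) = max(‖ξ - tφ‖, ‖φ‖^{1/(1+2β)})`. -/
noncomputable def Wgt (β : ℝ) {d : ℕ} (t : ℝ) (φ ξ : EuclideanSpace ℝ (Fin d)) : ℝ :=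
  max ‖ξ - t • φ‖ (‖φ‖ ^ (1 / (1 + 2 * β)))

/-- The Kolmogorov kernel `K(t,s,φ,ξ) = exp(-∫_s^t ‖ξ - τφ‖^{2β} dτ)`. -/
noncomputable def Kker (β : ℝ) {d : ℕ} (t s : ℝ) (φ ξ : EuclideanSpace ℝ (Fin d)) : ℝ :=
  Real.exp (-(∫ τ in s..t, ‖ξ - τ • φ‖ ^ (2 * β)))

/-- The integral over a set is controlled by the integrals over its bounded windows. -/
lemma setLIntegral_le_of_inter_Icc_le {S : Set ℝ} {h : ℝ → ℝ≥0∞} {B : ℝ≥0∞}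
    (hh : Measurable h) (hB : ∀ n : ℕ, ∫⁻ x in Set.Icc (-(n : ℝ)) n ∩ S, h x ≤ B) :
    ∫⁻ x in S, h x ≤ B := by
  have hc : AECover (volume.restrict S) Filter.atTop (fun n : ℕ => Set.Icc (-(n : ℝ)) n) :=
    (aecover_Icc (Filter.tendsto_neg_atTop_atBot.comp tendsto_natCast_atTop_atTop)
      tendsto_natCast_atTop_atTop).restrict
  refine le_of_tendsto (hc.lintegral_tendsto_of_countably_generated hh.aemeasurable)
    (Filter.Eventually.of_forall fun n => ?_)
  rw [Measure.restrict_restrict measurableSet_Icc]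
  exact hB n

/-- The fundamental theorem of calculus for the lower integral of a nonnegative derivative. -/
lemma lintegral_Icc_deriv_le {G h : ℝ → ℝ} (hG : ∀ x, HasDerivAt G (h x) x) (hc : Continuous h)
    (h0 : ∀ x, 0 ≤ h x) {a b : ℝ} (hab : a ≤ b) :
    ∫⁻ x in Set.Icc a b, ENNReal.ofReal (h x) ≤ ENNReal.ofReal (G b - G a) := by
  rw [← ofReal_integral_eq_lintegral_ofReal hc.continuousOn.integrableOn_Icc
    (Filter.Eventually.of_forall h0), integral_Icc_eq_integral_Ioc,
    ← intervalIntegral.integral_of_le hab,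
    intervalIntegral.integral_eq_sub_of_hasDerivAt (fun x _ => hG x) (hc.intervalIntegrable _ _)]

lemma lintegral_Iic_deriv_le {G h : ℝ → ℝ} (hG : ∀ x, HasDerivAt G (h x) x) (hc : Continuous h)
    (h0 : ∀ x, 0 ≤ h x) (G0 : ∀ x, 0 ≤ G x) (t : ℝ) :
    ∫⁻ x in Set.Iic t, ENNReal.ofReal (h x) ≤ ENNReal.ofReal (G t) := by
  refine setLIntegral_le_of_inter_Icc_le hc.measurable.ennreal_ofReal fun n => ?_
  calc _ ≤ ∫⁻ x in Set.Icc (min (-(n : ℝ)) t) t, ENNReal.ofReal (h x) :=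
        lintegral_mono_set fun x hx => ⟨(min_le_left _ _).trans hx.1.1, hx.2⟩
    _ ≤ _ := lintegral_Icc_deriv_le hG hc h0 (min_le_right _ _)
    _ ≤ _ := ENNReal.ofReal_le_ofReal (by linarith [G0 (min (-(n : ℝ)) t)])

lemma lintegral_Ici_deriv_le {G h : ℝ → ℝ} (hG : ∀ x, HasDerivAt G (h x) x) (hc : Continuous h)
    (h0 : ∀ x, 0 ≤ h x) (G0 : ∀ x, G x ≤ 0) (t : ℝ) :
    ∫⁻ x in Set.Ici t, ENNReal.ofReal (h x) ≤ ENNReal.ofReal (-G t) := by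
  refine setLIntegral_le_of_inter_Icc_le hc.measurable.ennreal_ofReal fun n => ?_
  calc _ ≤ ∫⁻ x in Set.Icc t (max n t), ENNReal.ofReal (h x) :=
        lintegral_mono_set fun x hx => ⟨hx.2, hx.1.2.trans (le_max_left _ _)⟩
    _ ≤ _ := lintegral_Icc_deriv_le hG hc h0 (le_max_right _ _)
    _ ≤ _ := ENNReal.ofReal_le_ofReal (by linarith [G0 (max n t)])

/-- The Cauchy–Schwarz inequality for lower integrals, in squared form. -/
lemma lintegral_mul_sq_le {α : Type*} [MeasurableSpace α] (μ : Measure α) {f g : α → ℝ≥0∞}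
    (hf : Measurable f) (hg : Measurable g) :
    (∫⁻ x, f x * g x ∂μ) ^ 2 ≤ (∫⁻ x, f x ^ 2 ∂μ) * ∫⁻ x, g x ^ 2 ∂μ := by
  have h := ENNReal.lintegral_mul_le_Lp_mul_Lq μ Real.HolderConjugate.two_two
    hf.aemeasurable hg.aemeasurable
  have hs : ∀ x : ℝ≥0∞, (x ^ (1 / 2 : ℝ)) ^ 2 = x := fun x => by
    rw [← ENNReal.rpow_natCast, ← ENNReal.rpow_mul]; norm_num
  simp only [ENNReal.rpow_ofNat] at h
  calc _ ≤ _ := pow_le_pow_left' h 2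
    _ = _ := by rw [mul_pow, hs, hs]

/-- Exchange of the order of integration over the half-plane `s ≤ t`. -/
lemma lintegral_Iic_swap {F : ℝ → ℝ → ℝ≥0∞} (hF : Measurable (Function.uncurry F)) :
    ∫⁻ t, ∫⁻ s in Set.Iic t, F t s = ∫⁻ s, ∫⁻ t in Set.Ici s, F t s := by
  have hm : MeasurableSet {p : ℝ × ℝ | p.2 ≤ p.1} := measurableSet_le measurable_snd measurable_fst
  have hsw := lintegral_lintegral_swap (μ := (volume : Measure ℝ)) (ν := (volume : Measure ℝ))
    (f := fun t s => Set.indicator {p : ℝ × ℝ | p.2 ≤ p.1} (Function.uncurry F) (t, s))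
    (hF.indicator hm).aemeasurable
  calc _ = _ := by
        refine lintegral_congr fun t => ?_
        rw [← lintegral_indicator measurableSet_Iic]
        rfl
    _ = _ := hsw
    _ = _ := by
        refine lintegral_congr fun s => ?_
        rw [← lintegral_indicator measurableSet_Ici]
        rfl

/-- Weighted bound for the causal kernel `exp (-(A t - A s))` when `A' = w ^ (2β)` and `w` varies
slowly with respect to `A`. -/
lemma lintegral_weighted_exp_kernel_le {β γ D : ℝ} {w A : ℝ → ℝ} (hw : Continuous w)
    (w0 : ∀ t, 0 < w t) (hA : ∀ t, HasDerivAt A (w t ^ (2 * β)) t) (hD : 0 ≤ D)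
    (hr : ∀ s t, s ≤ t →
      w t ^ (2 * γ - 2 * β) ≤ D * w s ^ (2 * γ - 2 * β) * exp ((A t - A s) / 2))
    {f : ℝ → ℝ≥0∞} (hf : Measurable f) :
    (∫⁻ t : ℝ, ENNReal.ofReal (w t ^ (2 * γ)) *
        (∫⁻ s in Set.Iic t, ENNReal.ofReal (exp (-(A t - A s))) * f s) ^ 2)
      ≤ ENNReal.ofReal (2 * D) * ∫⁻ s : ℝ, ENNReal.ofReal (w s ^ (2 * γ - 4 * β)) * f s ^ 2 := by
  have hAc : Continuous A := continuous_iff_continuousAt.2 fun t => (hA t).continuousAt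
  have hwc : ∀ r : ℝ, Continuous fun t => w t ^ r := fun r =>
    hw.rpow_const fun t => Or.inl (w0 t).ne'
  have hinner : ∀ t, (∫⁻ s in Set.Iic t, ENNReal.ofReal (exp (-(A t - A s))) * f s) ^ 2 ≤
      ∫⁻ s in Set.Iic t, ENNReal.ofReal (exp (-(A t - A s)) * w s ^ (-(2 * β))) * f s ^ 2 := by
    intro t
    set a : ℝ → ℝ≥0∞ := fun s => ENNReal.ofReal (exp (-(A t - A s) / 2) * w s ^ β)
    set b : ℝ → ℝ≥0∞ := fun s => ENNReal.ofReal (exp (-(A t - A s) / 2) * w s ^ (-β)) * f s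
    have ha : Measurable a := by
      have : Continuous fun s => exp (-(A t - A s) / 2) * w s ^ β := by
        have := hwc β; fun_prop
      exact this.measurable.ennreal_ofReal
    have hb : Measurable b := by
      have : Continuous fun s => exp (-(A t - A s) / 2) * w s ^ (-β) := by
        have := hwc (-β); fun_prop
      exact this.measurable.ennreal_ofReal.mul hf
    have hab : ∀ s, ENNReal.ofReal (exp (-(A t - A s))) * f s = a s * b s := by
      intro s
      simp only [a, b]
      rw [← mul_assoc, ← ENNReal.ofReal_mul (by have := w0 s; positivity)]
      congr 2
      rw [mul_mul_mul_comm, ← Real.exp_add, ← Real.rpow_add (w0 s)]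
      simp
    have ha2 : ∀ s, a s ^ 2 = ENNReal.ofReal (exp (-(A t - A s)) * w s ^ (2 * β)) := by
      intro s
      simp only [a]
      rw [sq, ← ENNReal.ofReal_mul (by have := w0 s; positivity), mul_mul_mul_comm,
        ← Real.exp_add, ← Real.rpow_add (w0 s), ← two_mul β, add_halves]
    have hb2 : ∀ s, b s ^ 2 =
        ENNReal.ofReal (exp (-(A t - A s)) * w s ^ (-(2 * β))) * f s ^ 2 := by
      intro s
      simp only [b]
      rw [mul_pow, sq (ENNReal.ofReal _), ← ENNReal.ofReal_mul (by have := w0 s; positivity),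
        mul_mul_mul_comm, ← Real.exp_add, ← Real.rpow_add (w0 s), ← two_mul (-β), add_halves,
        mul_neg]
    have h1 : ∫⁻ s in Set.Iic t, a s ^ 2 ≤ 1 := by
      simp only [ha2]
      refine (lintegral_Iic_deriv_le (G := fun s => exp (-(A t - A s))) (fun s => ?_) ?_ ?_
        (fun s => (exp_pos _).le) t).trans (by simp)
      · simpa using ((hA s).const_sub (A t)).neg.exp
      · have := hwc (2 * β); fun_prop
      · intro s; have := w0 s; positivity
    simp only [hab, ← hb2]
    exact (lintegral_mul_sq_le _ ha hb).trans (mul_le_of_le_one_left' h1)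
  have houter : ∀ s, ∫⁻ t in Set.Ici s, ENNReal.ofReal (w t ^ (2 * γ) * exp (-(A t - A s))) ≤
      ENNReal.ofReal (2 * D * w s ^ (2 * γ - 2 * β)) := by
    intro s
    have hle : ∀ t ∈ Set.Ici s, ENNReal.ofReal (w t ^ (2 * γ) * exp (-(A t - A s))) ≤
        ENNReal.ofReal (D * w s ^ (2 * γ - 2 * β)) *
          ENNReal.ofReal (exp (-(A t - A s) / 2) * w t ^ (2 * β)) := by
      intro t ht
      rw [← ENNReal.ofReal_mul (by have := w0 s; positivity)]
      refine ENNReal.ofReal_le_ofReal ?_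
      have e1 : w t ^ (2 * γ) = w t ^ (2 * γ - 2 * β) * w t ^ (2 * β) := by
        rw [← Real.rpow_add (w0 t), sub_add_cancel]
      have e2 : exp (-(A t - A s) / 2) = exp ((A t - A s) / 2) * exp (-(A t - A s)) := by
        rw [← Real.exp_add]; congr 1; ring
      rw [e1, e2]
      have h := mul_le_mul_of_nonneg_right (hr s t ht)
        (show 0 ≤ w t ^ (2 * β) * exp (-(A t - A s)) by have := w0 t; positivity)
      linarith
    have hG : ∫⁻ t in Set.Ici s, ENNReal.ofReal (exp (-(A t - A s) / 2) * w t ^ (2 * β)) ≤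
        ENNReal.ofReal 2 := by
      refine (lintegral_Ici_deriv_le (G := fun t => -2 * exp (-(A t - A s) / 2)) (fun t => ?_)
        ?_ ?_ (fun t => by have := exp_pos (-(A t - A s) / 2); linarith) s).trans (by simp)
      · refine ((((hA t).sub_const (A s)).neg.div_const 2).exp.const_mul (-2)).congr_deriv ?_
        simp only [Pi.neg_apply]
        ring
      · have := hwc (2 * β); fun_prop
      · intro t; have := w0 t; positivity
    calc _ ≤ _ := setLIntegral_mono' measurableSet_Ici hle
      _ = _ := lintegral_const_mul' _ _ ENNReal.ofReal_ne_top
      _ ≤ _ := mul_le_mul_right hG _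
      _ = _ := by
        rw [← ENNReal.ofReal_mul (by have := w0 s; positivity)]; ring_nf
  set F : ℝ → ℝ → ℝ≥0∞ := fun t s => ENNReal.ofReal (w t ^ (2 * γ) * exp (-(A t - A s))) *
    (ENNReal.ofReal (w s ^ (-(2 * β))) * f s ^ 2)
  have hF : Measurable (Function.uncurry F) := by
    have h1 : Continuous fun p : ℝ × ℝ => w p.1 ^ (2 * γ) * exp (-(A p.1 - A p.2)) := by
      have := (hwc (2 * γ)).comp (continuous_fst (X := ℝ) (Y := ℝ))
      simp only [Function.comp_def] at this
      fun_prop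
    have h2 : Measurable fun s => ENNReal.ofReal (w s ^ (-(2 * β))) * f s ^ 2 :=
      (hwc _).measurable.ennreal_ofReal.mul (hf.pow_const 2)
    exact h1.measurable.ennreal_ofReal.mul (h2.comp measurable_snd)
  calc _ ≤ ∫⁻ t, ∫⁻ s in Set.Iic t, F t s := by
        refine lintegral_mono fun t => ?_
        refine (mul_le_mul_right (hinner t) _).trans (le_of_eq ?_)
        rw [← lintegral_const_mul' _ _ ENNReal.ofReal_ne_top]
        refine lintegral_congr fun s => ?_
        simp only [F]
        rw [← mul_assoc, ← mul_assoc, ← ENNReal.ofReal_mul (by have := w0 t; positivity),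
          ← ENNReal.ofReal_mul (by have := w0 t; positivity), mul_assoc (w t ^ (2 * γ))]
    _ = ∫⁻ s, ∫⁻ t in Set.Ici s, F t s := lintegral_Iic_swap hF
    _ ≤ ∫⁻ s, ENNReal.ofReal (2 * D) * (ENNReal.ofReal (w s ^ (2 * γ - 4 * β)) * f s ^ 2) := by
        refine lintegral_mono fun s => ?_
        simp only [F]
        rw [lintegral_mul_const _ (by
          have : Continuous fun t => w t ^ (2 * γ) * exp (-(A t - A s)) := by
            have := hwc (2 * γ); fun_prop
          exact this.measurable.ennreal_ofReal)]
        refine (mul_le_mul_left (houter s) _).trans (le_of_eq ?_)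
        rw [← mul_assoc, ← mul_assoc, ← ENNReal.ofReal_mul (by have := w0 s; positivity),
          ← ENNReal.ofReal_mul (by positivity), mul_assoc (2 * D), ← Real.rpow_add (w0 s)]
        ring_nf
    _ = _ := lintegral_const_mul' _ _ ENNReal.ofReal_ne_top

/-- Over a window of length `x / (2c)` on which `w ≥ x / 2`, the primitive `A` of `w ^ (2β)`
increases by at least `(x / 2) ^ (1 + 2β) / c`. -/
lemma rpow_half_le_mul_sub {β c x a b : ℝ} {w A : ℝ → ℝ} (hβ : 0 < β) (hc : 0 < c) (hx : 0 < x)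
    (hA : ∀ t, HasDerivAt A (w t ^ (2 * β)) t) (hab : b - a = x / (2 * c))
    (hw : ∀ t, a ≤ t → t ≤ b → x / 2 ≤ w t) :
    (x / 2) ^ (1 + 2 * β) ≤ c * (A b - A a) := by
  have hle : a ≤ b := by
    have : 0 < x / (2 * c) := by positivity
    linarith
  have h := (convex_Icc a b).mul_sub_le_image_sub_of_le_deriv (f := A) (C := (x / 2) ^ (2 * β))
    (fun t _ => (hA t).continuousAt.continuousWithinAt)
    (fun t _ => (hA t).differentiableAt.differentiableWithinAt)
    (fun t ht => by
      rw [interior_Icc] at ht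
      rw [(hA t).deriv]
      exact Real.rpow_le_rpow (by positivity) (hw t ht.1.le ht.2.le) (by positivity))
    a (Set.left_mem_Icc.2 hle) b (Set.right_mem_Icc.2 hle) hle
  rw [hab] at h
  calc (x / 2) ^ (1 + 2 * β) = c * ((x / 2) ^ (2 * β) * (x / (2 * c))) := by
        rw [Real.rpow_add (by positivity), Real.rpow_one]; field_simp
    _ ≤ _ := by gcongr

/-- If `w` is `c`-Lipschitz with `c ≤ w ^ (1 + 2β)`, then `w` grows at most linearly with respect
to the primitive of `w ^ (2β)`, in both directions of time. -/
lemma slowly_varying {β c : ℝ} {w A : ℝ → ℝ} (hβ : 0 < β) (w0 : ∀ t, 0 < w t)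
    (hA : ∀ t, HasDerivAt A (w t ^ (2 * β)) t) (hL : ∀ s t, |w t - w s| ≤ c * |t - s|)
    (hcw : ∀ t, c ≤ w t ^ (1 + 2 * β)) {s t : ℝ} (hst : s ≤ t) :
    w t ≤ 2 * (1 + (A t - A s)) * w s ∧ w s ≤ 2 * (1 + (A t - A s)) * w t := by
  have hmono : Monotone A := monotone_of_hasDerivAt_nonneg hA
    fun t => (Real.rpow_pos_of_pos (w0 t) _).le
  have hA0 : 0 ≤ A t - A s := sub_nonneg.2 (hmono hst)
  have hfin : ∀ x y v : ℝ, 0 < x → y = w v → (x / 2) ^ (1 + 2 * β) ≤ c * (A t - A s) →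
      x ≤ 2 * (1 + (A t - A s)) * y := by
    intro x y v hx hy h
    have hy0 : 0 < y := hy ▸ w0 v
    have h1 : (x / 2) ^ (1 + 2 * β) ≤ ((1 + (A t - A s)) * y) ^ (1 + 2 * β) := by
      calc _ ≤ _ := h
        _ ≤ y ^ (1 + 2 * β) * (1 + (A t - A s)) := by
          have := hcw v
          rw [← hy] at this
          gcongr
          linarith
        _ ≤ y ^ (1 + 2 * β) * (1 + (A t - A s)) ^ (1 + 2 * β) := by
          gcongr
          exact Real.self_le_rpow_of_one_le (by linarith) (by linarith)
        _ = _ := by rw [Real.mul_rpow (by linarith) hy0.le, mul_comm]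
    have h2 := (Real.rpow_le_rpow_iff (by positivity) (by positivity) (by positivity)).1 h1
    linarith
  have htriv : ∀ x y : ℝ, 0 < y → x ≤ 2 * y → x ≤ 2 * (1 + (A t - A s)) * y := by
    intro x y hy h
    have := mul_nonneg hA0 hy.le
    linarith
  have hcpos : ∀ u v : ℝ, 2 * w v < w u → 0 < c := by
    intro u v h
    by_contra hc
    have h1 := hL v u
    have h2 : c * |u - v| ≤ 0 := mul_nonpos_of_nonpos_of_nonneg (not_lt.1 hc) (abs_nonneg _)
    have := le_abs_self (w u - w v)
    linarith [w0 v]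
  have hdist : ∀ u v : ℝ, 2 * w v < w u → w u / (2 * c) ≤ |u - v| := by
    intro u v h
    rw [div_le_iff₀ (by linarith [hcpos u v h])]
    have := (le_abs_self _).trans (hL v u)
    linarith
  have hnear : ∀ u v r : ℝ, 2 * w v < w u → |r - u| ≤ w u / (2 * c) → w u / 2 ≤ w r := by
    intro u v r h hr
    have hc := hcpos u v h
    have h1 := (neg_abs_le _).trans' (neg_le_neg (hL u r))
    have h2 : c * |r - u| ≤ c * (w u / (2 * c)) := by gcongr
    have h3 : c * (w u / (2 * c)) = w u / 2 := by field_simp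
    linarith
  constructor
  · rcases le_or_gt (w t) (2 * w s) with h | h
    · exact htriv _ _ (w0 s) h
    · have hd := hdist t s h
      rw [abs_of_nonneg (by linarith)] at hd
      have hc := hcpos t s h
      refine hfin _ _ s (w0 t) rfl ((rpow_half_le_mul_sub (a := t - w t / (2 * c)) (b := t) hβ hc
        (w0 t) hA (by ring) fun r h1 h2 => hnear t s r h ?_).trans ?_)
      · rw [abs_le]; constructor <;> linarith
      · have := hmono (show s ≤ t - w t / (2 * c) by linarith)
        gcongr
  · rcases le_or_gt (w s) (2 * w t) with h | h
    · exact htriv _ _ (w0 t) h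
    · have hd := hdist s t h
      rw [abs_sub_comm, abs_of_nonneg (by linarith)] at hd
      have hc := hcpos s t h
      refine hfin _ _ t (w0 s) rfl ((rpow_half_le_mul_sub (a := s) (b := s + w s / (2 * c)) hβ hc
        (w0 s) hA (by ring) fun r h1 h2 => hnear s t r h ?_).trans ?_)
      · rw [abs_le]; constructor <;> linarith
      · have := hmono (show s + w s / (2 * c) ≤ t by linarith)
        gcongr

/-- Comparability with linear loss gives comparability of all powers with exponential loss. -/
lemma rpow_le_of_linear_comparable {b x y L : ℝ} (hx : 0 < x) (hy : 0 < y) (hL : 0 ≤ L)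
    (hxy : x ≤ 2 * (1 + L) * y) (hyx : y ≤ 2 * (1 + L) * x) :
    x ^ b ≤ (4 * (|b| + 1)) ^ |b| * y ^ b * exp (L / 2) := by
  have hb := abs_nonneg b
  have h1 : x ^ b ≤ (2 * (1 + L)) ^ |b| * y ^ b := by
    rcases le_total 0 b with h | h
    · rw [abs_of_nonneg h, ← Real.mul_rpow (by positivity) hy.le]
      exact Real.rpow_le_rpow hx.le hxy h
    · have h2 : (2 * (1 + L) * x) ^ b ≤ y ^ b := Real.rpow_le_rpow_of_nonpos hy hyx h
      rw [Real.mul_rpow (by positivity) hx.le] at h2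
      rw [abs_of_nonpos h]
      calc x ^ b = (2 * (1 + L)) ^ (-b) * ((2 * (1 + L)) ^ b * x ^ b) := by
            rw [← mul_assoc, ← Real.rpow_add (by positivity)]; simp
        _ ≤ _ := by gcongr
  have h2 : 2 * (1 + L) ≤ 4 * (|b| + 1) * exp (L / (2 * (|b| + 1))) := by
    have h3 := Real.add_one_le_exp (L / (2 * (|b| + 1)))
    calc 2 * (1 + L) ≤ 4 * (|b| + 1) * (L / (2 * (|b| + 1)) + 1) := by
          have : 4 * (|b| + 1) * (L / (2 * (|b| + 1)) + 1) = 2 * L + 4 * (|b| + 1) := by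
            field_simp
            ring
          linarith
      _ ≤ _ := by gcongr
  have h3 : (2 * (1 + L)) ^ |b| ≤ (4 * (|b| + 1)) ^ |b| * exp (L / 2) := by
    calc _ ≤ (4 * (|b| + 1) * exp (L / (2 * (|b| + 1)))) ^ |b| :=
          Real.rpow_le_rpow (by positivity) h2 hb
      _ = (4 * (|b| + 1)) ^ |b| * exp (L / (2 * (|b| + 1)) * |b|) := by
          rw [Real.mul_rpow (by positivity) (exp_pos _).le, ← Real.exp_mul]
      _ ≤ _ := by
          gcongr
          rw [div_mul_eq_mul_div, div_le_div_iff₀ (by positivity) (by positivity)]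
          nlinarith
  calc _ ≤ _ := h1
    _ ≤ (4 * (|b| + 1)) ^ |b| * exp (L / 2) * y ^ b := by gcongr
    _ = _ := by ring

section Weight

variable {β : ℝ} {d : ℕ} {φ ξ : EuclideanSpace ℝ (Fin d)}

lemma Wgt_pos (h : (φ, ξ) ≠ (0, 0)) (t : ℝ) : 0 < Wgt β t φ ξ := by
  by_cases hφ : φ = 0
  · have hξ : ξ ≠ 0 := by rintro rfl; exact h (by rw [hφ])
    exact lt_max_of_lt_left (by simpa [hφ] using hξ)
  · exact lt_max_of_lt_right (Real.rpow_pos_of_pos (norm_pos_iff.2 hφ) _)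

lemma continuous_Wgt : Continuous fun t => Wgt β t φ ξ := by
  unfold Wgt; fun_prop

lemma abs_Wgt_sub_le (s t : ℝ) : |Wgt β t φ ξ - Wgt β s φ ξ| ≤ ‖φ‖ * |t - s| := by
  unfold Wgt
  refine (abs_max_sub_max_le_abs _ _ _).trans ((abs_norm_sub_norm_le _ _).trans (le_of_eq ?_))
  rw [show ξ - t • φ - (ξ - s • φ) = (s - t) • φ by rw [sub_smul]; abel, norm_smul,
    Real.norm_eq_abs, abs_sub_comm, mul_comm]

lemma rpow_one_div_rpow (hβ : 0 < β) :
    (‖φ‖ ^ (1 / (1 + 2 * β))) ^ (1 + 2 * β) = ‖φ‖ := by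
  rw [← Real.rpow_mul (norm_nonneg _), one_div_mul_cancel (by positivity), Real.rpow_one]

lemma norm_le_Wgt_rpow (hβ : 0 < β) (t : ℝ) : ‖φ‖ ≤ Wgt β t φ ξ ^ (1 + 2 * β) := by
  calc ‖φ‖ = (‖φ‖ ^ (1 / (1 + 2 * β))) ^ (1 + 2 * β) := (rpow_one_div_rpow hβ).symm
    _ ≤ _ := Real.rpow_le_rpow (by positivity) (le_max_right _ _) (by positivity)

/-- The set of times at which the weight is not `‖ξ - tφ‖` has length at most
`2 ‖φ‖ ^ (1 / (1 + 2β)) / ‖φ‖`. -/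
lemma volume_setOf_norm_lt_le (hφ : φ ≠ 0) (m : ℝ) :
    volume {t : ℝ | ‖ξ - t • φ‖ < m} ≤ ENNReal.ofReal (2 * m / ‖φ‖) := by
  refine (Real.volume_le_diam _).trans (Metric.ediam_le fun s hs t ht => ?_)
  have hn := norm_pos_iff.2 hφ
  rw [edist_dist]
  refine ENNReal.ofReal_le_ofReal ?_
  rw [le_div_iff₀ hn, Real.dist_eq]
  calc |s - t| * ‖φ‖ = ‖(ξ - t • φ) - (ξ - s • φ)‖ := by
        rw [show ξ - t • φ - (ξ - s • φ) = (s - t) • φ by rw [sub_smul]; abel, norm_smul,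
          Real.norm_eq_abs]
    _ ≤ _ := norm_sub_le _ _
    _ ≤ 2 * m := by
      have h1 : ‖ξ - s • φ‖ < m := hs
      have h2 : ‖ξ - t • φ‖ < m := ht
      linarith

lemma integral_Wgt_rpow_le (hβ : 0 < β) {s t : ℝ} (hst : s ≤ t) :
    ∫ τ in s..t, Wgt β τ φ ξ ^ (2 * β) ≤ (∫ τ in s..t, ‖ξ - τ • φ‖ ^ (2 * β)) + 2 := by
  have hu : Continuous fun τ : ℝ => ‖ξ - τ • φ‖ ^ (2 * β) :=
    (by fun_prop : Continuous fun τ : ℝ => ‖ξ - τ • φ‖).rpow_const fun _ => Or.inr (by positivity)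
  have hw : Continuous fun τ : ℝ => Wgt β τ φ ξ ^ (2 * β) :=
    continuous_Wgt.rpow_const fun _ => Or.inr (by positivity)
  by_cases hφ : φ = 0
  · subst hφ
    have : ∀ τ : ℝ, Wgt β τ 0 ξ = ‖ξ - τ • (0 : EuclideanSpace ℝ (Fin d))‖ := fun τ => by
      unfold Wgt
      rw [norm_zero, Real.zero_rpow (by positivity), max_eq_left (norm_nonneg _)]
    simp only [this]
    linarith
  have hn := norm_pos_iff.2 hφ
  set m := ‖φ‖ ^ (1 / (1 + 2 * β))
  have hm0 : 0 < m := Real.rpow_pos_of_pos hn _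
  have hmp : m ^ (1 + 2 * β) = ‖φ‖ := rpow_one_div_rpow hβ
  set S : Set ℝ := {τ : ℝ | ‖ξ - τ • φ‖ < m}
  have hSm : MeasurableSet S :=
    measurableSet_lt (by fun_prop : Continuous fun τ : ℝ => ‖ξ - τ • φ‖).measurable
      measurable_const
  have hvol : volume S ≤ ENNReal.ofReal (2 * m / ‖φ‖) := volume_setOf_norm_lt_le hφ m
  have hpt : ∀ τ, Wgt β τ φ ξ ^ (2 * β) - ‖ξ - τ • φ‖ ^ (2 * β) ≤
      S.indicator (fun _ => m ^ (2 * β)) τ := by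
    intro τ
    by_cases h : τ ∈ S
    · have h' : ‖ξ - τ • φ‖ < m := h
      rw [Set.indicator_of_mem h, show Wgt β τ φ ξ = m from max_eq_right h'.le]
      have : 0 ≤ ‖ξ - τ • φ‖ ^ (2 * β) := by positivity
      linarith
    · have h' : m ≤ ‖ξ - τ • φ‖ := not_lt.1 h
      rw [Set.indicator_of_notMem h, show Wgt β τ φ ξ = ‖ξ - τ • φ‖ from max_eq_left h', sub_self]
  have hint : Integrable (S.indicator fun _ : ℝ => m ^ (2 * β)) :=
    (integrable_indicator_iff hSm).2
      (integrableOn_const (hvol.trans_lt ENNReal.ofReal_lt_top).ne)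
  have hkey : (∫ τ in s..t, (Wgt β τ φ ξ ^ (2 * β) - ‖ξ - τ • φ‖ ^ (2 * β))) ≤ 2 := by
    calc _ ≤ ∫ τ in s..t, S.indicator (fun _ => m ^ (2 * β)) τ :=
          intervalIntegral.integral_mono_on hst ((hw.sub hu).intervalIntegrable _ _)
            hint.intervalIntegrable fun τ _ => hpt τ
      _ ≤ ∫ τ, S.indicator (fun _ => m ^ (2 * β)) τ := by
          rw [intervalIntegral.integral_of_le hst]
          exact setIntegral_le_integral hint (Filter.Eventually.of_forall fun τ =>
            Set.indicator_nonneg (fun _ _ => by positivity) τ)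
      _ = volume.real S * m ^ (2 * β) := by
          rw [integral_indicator hSm, setIntegral_const, smul_eq_mul]
      _ ≤ 2 * m / ‖φ‖ * m ^ (2 * β) := by
          gcongr
          exact ENNReal.toReal_le_of_le_ofReal (by positivity) hvol
      _ = 2 := by
          rw [← hmp, Real.rpow_add hm0, Real.rpow_one]
          field_simp
  rw [intervalIntegral.integral_sub (hw.intervalIntegrable _ _) (hu.intervalIntegrable _ _)] at hkey
  linarith

lemma Kker_le (hβ : 0 < β) {s t : ℝ} (hst : s ≤ t) :
    Kker β t s φ ξ ≤ exp 2 * exp (-∫ τ in s..t, Wgt β τ φ ξ ^ (2 * β)) := by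
  unfold Kker
  rw [← Real.exp_add]
  exact Real.exp_le_exp.2 (by linarith [integral_Wgt_rpow_le (φ := φ) (ξ := ξ) hβ hst])

end Weight

/-- Proposition 2.16, first item: `T : L²(W^{2γ-4β}) → L²(W^{2γ})` is bounded, with a
constant depending only on `β` and `γ`. -/
theorem duhamel_L2_to_L2 (β γ : ℝ) (hβ : 0 < β) :
    ∃ C : ℝ≥0∞, C ≠ ⊤ ∧
      ∀ (d : ℕ), 1 ≤ d → ∀ φ ξ : EuclideanSpace ℝ (Fin d), (φ, ξ) ≠ (0, 0) →
        ∀ f : ℝ → ℝ≥0∞, Measurable f →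
          (∫⁻ t : ℝ, ENNReal.ofReal (Wgt β t φ ξ ^ (2 * γ)) *
              (∫⁻ s in Set.Iic t, ENNReal.ofReal (Kker β t s φ ξ) * f s) ^ 2)
            ≤ C * ∫⁻ s : ℝ, ENNReal.ofReal (Wgt β s φ ξ ^ (2 * γ - 4 * β)) * f s ^ 2 := by
  set b := 2 * γ - 2 * β
  set D : ℝ := (4 * (|b| + 1)) ^ |b|
  have hD0 : 0 ≤ D := by positivity
  refine ⟨ENNReal.ofReal (exp 2) ^ 2 * ENNReal.ofReal (2 * D),
    ENNReal.mul_ne_top (ENNReal.pow_ne_top ENNReal.ofReal_ne_top) ENNReal.ofReal_ne_top, ?_⟩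
  intro d _ φ ξ hne f hf
  set w : ℝ → ℝ := fun t => Wgt β t φ ξ
  have w0 : ∀ t, 0 < w t := Wgt_pos hne
  have hw : Continuous w := continuous_Wgt
  have hwc : Continuous fun t => w t ^ (2 * β) := hw.rpow_const fun t => Or.inl (w0 t).ne'
  set A : ℝ → ℝ := fun t => ∫ τ in (0 : ℝ)..t, w τ ^ (2 * β)
  have hA : ∀ t, HasDerivAt A (w t ^ (2 * β)) t := fun t => hwc.integral_hasStrictDerivAt 0 t
    |>.hasDerivAt
  have hmono : Monotone A := monotone_of_hasDerivAt_nonneg hA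
    fun t => (Real.rpow_pos_of_pos (w0 t) _).le
  have hr : ∀ s t, s ≤ t → w t ^ b ≤ D * w s ^ b * exp ((A t - A s) / 2) := by
    intro s t hst
    obtain ⟨h1, h2⟩ := slowly_varying hβ w0 hA abs_Wgt_sub_le (norm_le_Wgt_rpow hβ) hst
    exact rpow_le_of_linear_comparable (w0 t) (w0 s) (sub_nonneg.2 (hmono hst)) h1 h2
  have hK : ∀ t, ∫⁻ s in Set.Iic t, ENNReal.ofReal (Kker β t s φ ξ) * f s ≤
      ENNReal.ofReal (exp 2) * ∫⁻ s in Set.Iic t, ENNReal.ofReal (exp (-(A t - A s))) * f s := by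
    intro t
    rw [← lintegral_const_mul' _ _ ENNReal.ofReal_ne_top]
    refine setLIntegral_mono' measurableSet_Iic fun s hs => ?_
    rw [← mul_assoc, ← ENNReal.ofReal_mul (exp_pos _).le]
    gcongr
    have h := Kker_le (φ := φ) (ξ := ξ) hβ hs
    rwa [← intervalIntegral.integral_interval_sub_left (hwc.intervalIntegrable 0 t)
      (hwc.intervalIntegrable 0 s)] at h
  calc _ ≤ ∫⁻ t, ENNReal.ofReal (exp 2) ^ 2 * (ENNReal.ofReal (w t ^ (2 * γ)) *
        (∫⁻ s in Set.Iic t, ENNReal.ofReal (exp (-(A t - A s))) * f s) ^ 2) := by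
        refine lintegral_mono fun t => ?_
        rw [mul_left_comm, ← mul_pow]
        exact mul_le_mul_right (pow_le_pow_left' (hK t) 2) _
    _ = _ := lintegral_const_mul' _ _ (ENNReal.pow_ne_top ENNReal.ofReal_ne_top)
    _ ≤ _ := by
        rw [mul_assoc]
        exact mul_le_mul_right (lintegral_weighted_exp_kernel_le hw w0 hA hD0 hr hf) _
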